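/- Suppose the positive integer sequences (m_k), (n_k) satisfy Keane's conditions together with m_k ≥ k² n_k for all k ≥ 1, and that \bar A_{m_1,n_1}\cdots\bar A_{m_k,n_k}(e_2) converges as k → ∞ to a vector u. Then for every k ≥ 1 and every vector v ∈ ℝ⁴ with nonnegative entries satisfying B_k v = u, one has v_2/|v|_1 > k²/(k²+4). -/

import Mathlib

open MeasureTheory Filter Set Matrix Topology

noncomputable section

/-- Keane's 4×4 matrix `A_{m,n}` with rows (0,0,1,1), (m−1,m,0,0), (n,n,n−1,n), (1,1,1,1). -/
def Amat (m n : ℕ) : Matrix (Fin 4) (Fin 4) ℝ :=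
  !![0, 0, 1, 1;
     (m : ℝ) - 1, (m : ℝ), 0, 0;
     (n : ℝ), (n : ℝ), (n : ℝ) - 1, (n : ℝ);
     1, 1, 1, 1]

/-- `B_k = A_{m_1,n_1} A_{m_2,n_2} ⋯ A_{m_k,n_k}` (sequences indexed from 1). -/
def Bmat (m n : ℕ → ℕ) (k : ℕ) : Matrix (Fin 4) (Fin 4) ℝ :=
  ((List.range k).map fun i => Amat (m (i + 1)) (n (i + 1))).prod

/-- `|v|₁`, the sum of the absolute values of the entries of `v`. -/
def l1norm (v : Fin 4 → ℝ) : ℝ := ∑ i, |v i|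

/-- `b_{k,i} = |B_k e_i|₁`; here columns are indexed from 0, so `e_i` is the
basis vector with a 1 in position `i` where `i : Fin 4` (e.g. the paper's `e_2` is `i = 1`). -/
def bnum (m n : ℕ → ℕ) (k : ℕ) (i : Fin 4) : ℝ := l1norm fun j => Bmat m n k j i

/-- `Ā_{m,n}(v) = A_{m,n} v / |A_{m,n} v|₁`. -/
def Abar (m n : ℕ) (v : Fin 4 → ℝ) : Fin 4 → ℝ :=
  (l1norm (Amat m n *ᵥ v))⁻¹ • (Amat m n *ᵥ v)

/-- `barSeq m n k v = Ā_{m_1,n_1} Ā_{m_2,n_2} ⋯ Ā_{m_k,n_k} (v)`. -/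
def barSeq (m n : ℕ → ℕ) : ℕ → (Fin 4 → ℝ) → Fin 4 → ℝ
  | 0, v => v
  | k + 1, v => barSeq m n k (Abar (m (k + 1)) (n (k + 1)) v)

/-- The paper's `e₂ = (0,1,0,0)ᵀ`. -/
def e2 : Fin 4 → ℝ := ![0, 1, 0, 0]

/-- The paper's `e₃ = (0,0,1,0)ᵀ`. -/
def e3 : Fin 4 → ℝ := ![0, 0, 1, 0]

/-- Keane's conditions: the sequences are positive integers, `3(n_k+1) ≤ m_k ≤ (n_{k+1}+1)/2`
for all `k ≥ 1`, and `n_1 ≥ 10`. -/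
def KeaneCond (m n : ℕ → ℕ) : Prop :=
  (∀ k, 1 ≤ k → 1 ≤ m k ∧ 1 ≤ n k) ∧
  (∀ k, 1 ≤ k → 3 * (n k + 1) ≤ m k ∧ 2 * m k ≤ n (k + 1) + 1) ∧
  10 ≤ n 1

/-- The permutation (4213) (one-indexed: π(1)=4, π(2)=2, π(3)=1, π(4)=3), written zero-indexed. -/
def kperm : Fin 4 → Fin 4 := ![3, 1, 0, 2]

/-- The 4-interval exchange transformation with length vector `l` and permutation (4213):
on `I_j = [l_1+⋯+l_{j−1}, l_1+⋯+l_j)` it is `x ↦ x − ∑_{k<j} l_k + ∑_{π(k')<π(j)} l_{k'}`. -/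
def iet (l : Fin 4 → ℝ) (x : ℝ) : ℝ :=
  if x < l 0 then
    x + ∑ k ∈ Finset.univ.filter (fun k => kperm k < kperm 0), l k
  else if x < l 0 + l 1 then
    x - l 0 + ∑ k ∈ Finset.univ.filter (fun k => kperm k < kperm 1), l k
  else if x < l 0 + l 1 + l 2 then
    x - (l 0 + l 1) + ∑ k ∈ Finset.univ.filter (fun k => kperm k < kperm 2), l k
  else
    x - (l 0 + l 1 + l 2) + ∑ k ∈ Finset.univ.filter (fun k => kperm k < kperm 3), l k

/-- The IET regarded as a self-map of `ℝ`, extended by the identity off `[0,1)`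
(a measure `μ` with `μ [0,1) = 1` then plays the role of a Borel measure on `[0,1)`). -/
def ietFull (l : Fin 4 → ℝ) (x : ℝ) : ℝ :=
  if x ∈ Set.Ico (0 : ℝ) 1 then iet l x else x

/-- The cone of nonnegative vectors whose second entry dominates the sum of the others. -/
def domCone : Set (Fin 4 → ℝ) :=
  {y | (∀ i, 0 ≤ y i) ∧ y 0 + y 2 + y 3 ≤ y 1}

/-- The inverse of `Amat m n`. -/
def AmatInv (m n : ℕ) : Matrix (Fin 4) (Fin 4) ℝ :=
  !![-(m : ℝ), -1, 0, (m : ℝ);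
     (m : ℝ) - 1, 1, 0, 1 - (m : ℝ);
     0, 0, -1, (n : ℝ);
     1, 0, 1, -(n : ℝ)]

lemma AmatInv_mul_Amat (m n : ℕ) : AmatInv m n * Amat m n = 1 := by
  ext i j
  fin_cases i <;> fin_cases j <;>
    simp [AmatInv, Amat, Matrix.mul_apply, Fin.sum_univ_four]

lemma isUnit_Amat (m n : ℕ) : IsUnit (Amat m n) :=
  IsUnit.of_mul_eq_one_right (AmatInv m n) (AmatInv_mul_Amat m n)

lemma Bmat_succ (m n : ℕ → ℕ) (k : ℕ) :
    Bmat m n (k + 1) = Bmat m n k * Amat (m (k + 1)) (n (k + 1)) := by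
  simp [Bmat, List.range_succ]

lemma isUnit_Bmat (m n : ℕ → ℕ) (k : ℕ) : IsUnit (Bmat m n k) := by
  induction k with
  | zero => simp [Bmat]
  | succ k ih => rw [Bmat_succ]; exact ih.mul (isUnit_Amat _ _)

lemma l1norm_of_nonneg {v : Fin 4 → ℝ} (hv : ∀ i, 0 ≤ v i) : l1norm v = ∑ i, v i :=
  Finset.sum_congr rfl fun i _ => abs_of_nonneg (hv i)

lemma Amat_mulVec (m n : ℕ) (y : Fin 4 → ℝ) :
    Amat m n *ᵥ y = ![y 2 + y 3, ((m : ℝ) - 1) * y 0 + m * y 1,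
      n * y 0 + n * y 1 + ((n : ℝ) - 1) * y 2 + n * y 3, y 0 + y 1 + y 2 + y 3] := by
  ext i
  fin_cases i <;> simp [Amat, Matrix.mulVec, dotProduct, Fin.sum_univ_four]

lemma isClosed_domCone : IsClosed domCone := by
  have : domCone = (⋂ i, {y : Fin 4 → ℝ | 0 ≤ y i}) ∩ {y | y 0 + y 2 + y 3 ≤ y 1} := by
    ext y; simp [domCone]
  rw [this]
  exact (isClosed_iInter fun i => isClosed_le (by fun_prop) (by fun_prop)).inter
    (isClosed_le (by fun_prop) (by fun_prop))

lemma smul_mem_domCone {c : ℝ} (hc : 0 ≤ c) {y : Fin 4 → ℝ} (hy : y ∈ domCone) :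
    c • y ∈ domCone := by
  refine ⟨fun i => mul_nonneg hc (hy.1 i), ?_⟩
  have := mul_le_mul_of_nonneg_left hy.2 hc
  simp only [Pi.smul_apply, smul_eq_mul]
  linarith

lemma Amat_mulVec_mem_domCone {m n : ℕ} (hn : 1 ≤ n) (hm : 3 * (n + 1) ≤ m)
    {y : Fin 4 → ℝ} (hy : y ∈ domCone) : Amat m n *ᵥ y ∈ domCone := by
  obtain ⟨h, hd⟩ := hy
  have hn' : (1 : ℝ) ≤ n := by exact_mod_cast hn
  have hm' : 3 * ((n : ℝ) + 1) ≤ m := by exact_mod_cast hm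
  have h0 := h 0
  have h1 := h 1
  have h2 := h 2
  have h3 := h 3
  have e0 : 0 ≤ ((m : ℝ) - 1) * y 0 := mul_nonneg (by linarith) h0
  have e1 : 3 * ((n : ℝ) + 1) * y 1 ≤ m * y 1 := mul_le_mul_of_nonneg_right hm' h1
  have e2 : (n : ℝ) * (y 0 + y 2 + y 3) ≤ n * y 1 := mul_le_mul_of_nonneg_left hd (by linarith)
  have e3 : 0 ≤ ((n : ℝ) - 1) * y 2 := mul_nonneg (by linarith) h2
  have e4 : y 1 ≤ n * y 1 := le_mul_of_one_le_left h1 hn'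
  rw [Amat_mulVec]
  refine ⟨fun i => ?_, ?_⟩
  · fin_cases i <;> simp <;> nlinarith
  · simp
    nlinarith

lemma l1norm_Amat_mulVec_pos {m n : ℕ} {y : Fin 4 → ℝ} (hy : y ∈ domCone) (hpos : 0 < y 1) :
    0 < l1norm (Amat m n *ᵥ y) := by
  have h3 : 0 < (Amat m n *ᵥ y) 3 := by
    rw [Amat_mulVec]
    simp only [cons_val]
    linarith [hy.1 0, hy.1 2, hy.1 3]
  exact Finset.sum_pos' (fun i _ => abs_nonneg _) ⟨3, Finset.mem_univ _, abs_pos.2 h3.ne'⟩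

lemma pos_of_mem_domCone {y : Fin 4 → ℝ} (hy : y ∈ domCone) (hs : ∑ i, y i = 1) : 0 < y 1 := by
  rw [Fin.sum_univ_four] at hs
  linarith [hy.2]

lemma Abar_mem {m n : ℕ} (hn : 1 ≤ n) (hm : 3 * (n + 1) ≤ m) {y : Fin 4 → ℝ}
    (hy : y ∈ domCone) (hs : ∑ i, y i = 1) :
    Abar m n y ∈ domCone ∧ ∑ i, Abar m n y i = 1 := by
  have hA := Amat_mulVec_mem_domCone hn hm hy
  have hl := l1norm_Amat_mulVec_pos (m := m) (n := n) hy (pos_of_mem_domCone hy hs)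
  refine ⟨smul_mem_domCone (inv_nonneg.2 hl.le) hA, ?_⟩
  simp only [Abar, Pi.smul_apply, smul_eq_mul, ← Finset.mul_sum]
  rw [← l1norm_of_nonneg hA.1, inv_mul_cancel₀ hl.ne']

lemma barSeq_eq_smul {m n : ℕ → ℕ} (hn : ∀ k, 1 ≤ n (k + 1))
    (hm : ∀ k, 3 * (n (k + 1) + 1) ≤ m (k + 1)) (k : ℕ) {y : Fin 4 → ℝ}
    (hy : y ∈ domCone) (hs : ∑ i, y i = 1) :
    ∃ c : ℝ, 0 ≤ c ∧ barSeq m n k y = c • (Bmat m n k *ᵥ y) := by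
  induction k generalizing y with
  | zero => exact ⟨1, zero_le_one, by simp [barSeq, Bmat]⟩
  | succ k ih =>
    obtain ⟨hA, hAs⟩ := Abar_mem (hn k) (hm k) hy hs
    obtain ⟨c, hc, he⟩ := ih hA hAs
    refine ⟨c * (l1norm (Amat (m (k + 1)) (n (k + 1)) *ᵥ y))⁻¹,
      mul_nonneg hc (inv_nonneg.2 (Finset.sum_nonneg fun _ _ => abs_nonneg _)), ?_⟩
    rw [barSeq, he, Bmat_succ, Abar, Matrix.mulVec_smul, smul_smul, Matrix.mulVec_mulVec]

lemma exists_barSeq_add_eq {m n : ℕ → ℕ} (hn : ∀ k, 1 ≤ n (k + 1))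
    (hm : ∀ k, 3 * (n (k + 1) + 1) ≤ m (k + 1)) (j i : ℕ) {y : Fin 4 → ℝ}
    (hy : y ∈ domCone) (hs : ∑ i, y i = 1) :
    ∃ w ∈ domCone, ∑ i, w i = 1 ∧ barSeq m n (j + i) y = barSeq m n j w := by
  induction i generalizing y with
  | zero => exact ⟨y, hy, hs, rfl⟩
  | succ i ih =>
    obtain ⟨hA, hAs⟩ := Abar_mem (hn (j + i)) (hm (j + i)) hy hs
    exact ih hA hAs

/-- A limit of the normalized products lies in the image of the cone under every `B_j`. -/
lemma exists_Bmat_mulVec_eq_of_tendsto {m n : ℕ → ℕ} (hn : ∀ k, 1 ≤ n (k + 1))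
    (hm : ∀ k, 3 * (n (k + 1) + 1) ≤ m (k + 1)) {u y : Fin 4 → ℝ}
    (hy : y ∈ domCone) (hs : ∑ i, y i = 1)
    (hu : Tendsto (fun k => barSeq m n k y) atTop (𝓝 u)) (j : ℕ) :
    ∃ z ∈ domCone, Bmat m n j *ᵥ z = u := by
  have hdet := (Matrix.isUnit_iff_isUnit_det _).1 (isUnit_Bmat m n j)
  refine ⟨(Bmat m n j)⁻¹ *ᵥ u, ?_, by
    rw [Matrix.mulVec_mulVec, Matrix.mul_nonsing_inv _ hdet, Matrix.one_mulVec]⟩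
  have hcont : Continuous fun x : Fin 4 → ℝ => (Bmat m n j)⁻¹ *ᵥ x := by fun_prop
  refine isClosed_domCone.mem_of_tendsto ((hcont.tendsto u).comp hu) ?_
  filter_upwards [eventually_ge_atTop j] with k hk
  obtain ⟨i, rfl⟩ := Nat.exists_eq_add_of_le hk
  obtain ⟨w, hw, hws, he⟩ := exists_barSeq_add_eq hn hm j i hy hs
  obtain ⟨c, hc, he'⟩ := barSeq_eq_smul hn hm j hw hws
  simp only [Function.comp_apply]
  rw [he, he', Matrix.mulVec_smul, Matrix.mulVec_mulVec, Matrix.nonsing_inv_mul _ hdet,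
    Matrix.one_mulVec]
  exact smul_mem_domCone hc hw

lemma sum_eq_one_of_tendsto_barSeq {m n : ℕ → ℕ} (hn : ∀ k, 1 ≤ n (k + 1))
    (hm : ∀ k, 3 * (n (k + 1) + 1) ≤ m (k + 1)) {u y : Fin 4 → ℝ}
    (hy : y ∈ domCone) (hs : ∑ i, y i = 1)
    (hu : Tendsto (fun k => barSeq m n k y) atTop (𝓝 u)) : ∑ i, u i = 1 := by
  have hsum : Tendsto (fun k => ∑ i, barSeq m n k y i) atTop (𝓝 (∑ i, u i)) :=
    tendsto_finsetSum _ fun i _ => (tendsto_pi_nhds.1 hu) i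
  refine tendsto_nhds_unique hsum (tendsto_const_nhds.congr fun k => ?_)
  obtain ⟨w, -, hws, he⟩ := exists_barSeq_add_eq hn hm 0 k hy hs
  rw [Nat.zero_add] at he
  rw [he, barSeq, hws]

lemma KeaneCond.ten_le {m n : ℕ → ℕ} (hK : KeaneCond m n) (k : ℕ) : 10 ≤ n (k + 1) := by
  induction k with
  | zero => exact hK.2.2
  | succ k ih =>
    have := hK.2.1 (k + 1) (by omega)
    omega

lemma sq_div_lt_Amat_mulVec_ratio {m n k : ℕ} (hn : 10 ≤ n) (hm : (k + 1) ^ 2 * n ≤ m)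
    {z : Fin 4 → ℝ} (hz : z ∈ domCone) (hpos : 0 < z 1)
    (hv : ∀ i, 0 ≤ (Amat m n *ᵥ z) i) :
    (k : ℝ) ^ 2 / ((k : ℝ) ^ 2 + 4) < (Amat m n *ᵥ z) 1 / l1norm (Amat m n *ᵥ z) := by
  rw [div_lt_div_iff₀ (by positivity) (l1norm_Amat_mulVec_pos hz hpos), l1norm_of_nonneg hv,
    Fin.sum_univ_four, Amat_mulVec]
  simp only [cons_val]
  obtain ⟨h, hd⟩ := hz
  have hn' : (10 : ℝ) ≤ n := by exact_mod_cast hn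
  have hm' : ((k : ℝ) + 1) ^ 2 * n ≤ m := by exact_mod_cast hm
  have hk : (0 : ℝ) ≤ k := Nat.cast_nonneg k
  have hm1 : (1 : ℝ) ≤ m := by nlinarith
  have e0 : 0 ≤ ((m : ℝ) - 1) * z 0 := mul_nonneg (by linarith) (h 0)
  have hoth : z 2 + z 3 + (n * z 0 + n * z 1 + ((n : ℝ) - 1) * z 2 + n * z 3)
      + (z 0 + z 1 + z 2 + z 3) ≤ 2 * (n + 2) * z 1 := by
    nlinarith [h 0, h 1, h 2, h 3]
  have e1 := mul_le_mul_of_nonneg_left hoth (sq_nonneg (k : ℝ))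
  have e2 : (k : ℝ) ^ 2 * (2 * (n + 2)) < 4 * m := by nlinarith
  have e3 := mul_lt_mul_of_pos_right e2 hpos
  linarith

lemma e2_mem_domCone : e2 ∈ domCone := by
  refine ⟨fun i => ?_, by simp [e2]⟩
  fin_cases i <;> simp [e2]

/-- Lemma 5: under Keane's conditions together with `m_k ≥ k² n_k`, if `B_k v = u` with `v ≥ 0`,
then `v₂/|v|₁ > k²/(k²+4)`. -/
theorem lemma_five (m n : ℕ → ℕ) (hK : KeaneCond m n)
    (hmn : ∀ k, 1 ≤ k → k ^ 2 * n k ≤ m k)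
    (u : Fin 4 → ℝ)
    (hconv : Tendsto (fun k => barSeq m n k e2) atTop (𝓝 u)) :
    ∀ k, 1 ≤ k → ∀ v : Fin 4 → ℝ, (∀ i, 0 ≤ v i) → Bmat m n k *ᵥ v = u →
      ((k : ℝ) ^ 2) / ((k : ℝ) ^ 2 + 4) < v 1 / l1norm v := by
  have hn : ∀ k, 1 ≤ n (k + 1) := fun k => (hK.1 (k + 1) (by omega)).2
  have hm : ∀ k, 3 * (n (k + 1) + 1) ≤ m (k + 1) := fun k => (hK.2.1 (k + 1) (by omega)).1
  have hs : ∑ i, e2 i = 1 := by simp [e2, Fin.sum_univ_four]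
  intro k _ v hv hBv
  obtain ⟨z, hz, hBz⟩ :=
    exists_Bmat_mulVec_eq_of_tendsto hn hm e2_mem_domCone hs hconv (k + 1)
  have hvz : v = Amat (m (k + 1)) (n (k + 1)) *ᵥ z := by
    refine Matrix.mulVec_injective_of_isUnit (isUnit_Bmat m n k) ?_
    rw [hBv, Matrix.mulVec_mulVec, ← Bmat_succ, hBz]
  have hpos : 0 < z 1 := by
    refine (hz.1 1).lt_of_ne' fun h1 => ?_
    have hz0 : z = 0 := by
      ext i
      have hd := hz.2
      have h0 := hz.1 0
      have h2 := hz.1 2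
      have h3 := hz.1 3
      fin_cases i <;> simp <;> linarith
    have hu := sum_eq_one_of_tendsto_barSeq hn hm e2_mem_domCone hs hconv
    rw [← hBz, hz0, Matrix.mulVec_zero] at hu
    simp at hu
  subst hvz
  exact sq_div_lt_Amat_mulVec_ratio (hK.ten_le k) (hmn (k + 1) (by omega)) hz hpos hv
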